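/- Let Δx > 0, x_m = m·Δx, and let f_{i−1}, f_i, f_{i+1} be real numbers. Let p be the unique polynomial of degree at most 2 whose cell averages over cells i−1, i, i+1 equal f_{i−1}, f_i, f_{i+1}, i.e. (1/Δx)∫_{x_m−Δx/2}^{x_m+Δx/2} p(ξ)dξ = f_m for m = i−1, i, i+1. Then the smoothness indicator β = Σ_{j=1}^{2} Δx^{2j−1} ∫_{x_i−Δx/2}^{x_i+Δx/2} (p^{(j)}(x))² dx evaluates to β = (13/12)·(f_{i−1} − 2f_i + f_{i+1})² + (1/4)·(f_{i−1} − f_{i+1})². (The Jiang–Shu smoothness indicator of the central 3-point stencil.) -/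

import Mathlib

/-- The integral of a real quadratic polynomial over an interval. -/
theorem integral_quadratic (a b c u v : ℝ) :
    ∫ x in u..v, (a * x ^ 2 + b * x + c) =
      a * (v ^ 3 - u ^ 3) / 3 + b * (v ^ 2 - u ^ 2) / 2 + c * (v - u) := by
  have h : ∀ x ∈ Set.uIcc u v,
      HasDerivAt (fun x : ℝ => a * x ^ 3 / 3 + b * x ^ 2 / 2 + c * x)
        (a * x ^ 2 + b * x + c) x := by
    intro x _
    have h₃ := ((hasDerivAt_pow 3 x).const_mul a).div_const 3
    have h₂ := ((hasDerivAt_pow 2 x).const_mul b).div_const 2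
    refine ((h₃.add h₂).add ((hasDerivAt_id x).const_mul c)).congr_deriv ?_
    push_cast
    ring
  rw [intervalIntegral.integral_eq_sub_of_hasDerivAt h
    (Continuous.intervalIntegrable (by fun_prop) _ _)]
  ring

/-- The Jiang–Shu smoothness indicator of the central 3-point stencil:
if `p` is a polynomial of degree at most 2 whose cell averages over the cells
`i-1, i, i+1` are `fm, fc, fp`, then
`Δx ∫ (p')² + Δx³ ∫ (p'')² = (13/12)(fm - 2 fc + fp)² + (1/4)(fm - fp)²`,
the integrals being over the cell `[x_i - Δx/2, x_i + Δx/2]`. -/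
theorem jiang_shu_beta_central (Δx : ℝ) (hΔx : 0 < Δx) (i : ℤ)
    (fm fc fp : ℝ) (p : Polynomial ℝ) (hdeg : p.degree ≤ 2)
    (havg_m : (1 / Δx) *
        ∫ ξ in (((i : ℝ) - 1) * Δx - Δx / 2)..(((i : ℝ) - 1) * Δx + Δx / 2),
          p.eval ξ = fm)
    (havg_c : (1 / Δx) *
        ∫ ξ in ((i : ℝ) * Δx - Δx / 2)..((i : ℝ) * Δx + Δx / 2),
          p.eval ξ = fc)
    (havg_p : (1 / Δx) *
        ∫ ξ in (((i : ℝ) + 1) * Δx - Δx / 2)..(((i : ℝ) + 1) * Δx + Δx / 2),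
          p.eval ξ = fp) :
    Δx ^ (2 * 1 - 1) *
        (∫ x in ((i : ℝ) * Δx - Δx / 2)..((i : ℝ) * Δx + Δx / 2),
          ((Polynomial.derivative p).eval x) ^ 2) +
      Δx ^ (2 * 2 - 1) *
        (∫ x in ((i : ℝ) * Δx - Δx / 2)..((i : ℝ) * Δx + Δx / 2),
          ((Polynomial.derivative (Polynomial.derivative p)).eval x) ^ 2)
      = (13 / 12) * (fm - 2 * fc + fp) ^ 2 + (1 / 4) * (fm - fp) ^ 2 := by
  obtain ⟨a, b, c, rfl⟩ : ∃ a b c : ℝ,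
      p = Polynomial.C a * Polynomial.X ^ 2 + Polynomial.C b * Polynomial.X + Polynomial.C c :=
    ⟨_, _, _, Polynomial.eq_quadratic_of_degree_le_two hdeg⟩
  have hsq : ∀ x : ℝ, (a * (2 * x) + b) ^ 2 = 4 * a ^ 2 * x ^ 2 + 4 * a * b * x + b ^ 2 :=
    fun x => by ring
  simp only [Polynomial.eval_add, Polynomial.eval_mul, Polynomial.eval_C, Polynomial.eval_pow,
    Polynomial.eval_X, integral_quadratic] at havg_m havg_c havg_p
  simp only [Polynomial.derivative_add, Polynomial.derivative_C_mul, Polynomial.derivative_X_sq,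
    Polynomial.derivative_X, Polynomial.derivative_C, Polynomial.eval_add, Polynomial.eval_mul,
    Polynomial.eval_C, Polynomial.eval_X, mul_one, add_zero, hsq, integral_quadratic, intervalIntegral.integral_const, smul_eq_mul]
  have hsecond : fm - 2 * fc + fp = 2 * a * Δx ^ 2 := by
    rw [← havg_m, ← havg_c, ← havg_p]
    field_simp
    ring
  have hfirst : fm - fp = -(2 * Δx * (2 * a * (i * Δx) + b)) := by
    rw [← havg_m, ← havg_p]
    field_simp
    ring
  rw [hsecond, hfirst]
  ring
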